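/- Let ℓ ≥ 1, q = 2^ℓ, and let r be an integer with 1 ≤ r ≤ q − 1. Consider the F_q-vector space C = { f ∈ F_q[x,y] : deg_x f ≤ q−1, deg_y f ≤ q−1, and for all α, β, γ ∈ F_q the remainder of f(X, αX²+βX+γ) upon division by X^q − X has degree less than q − r }. Then the dimension of C over F_q equals the number of pairs (a, b) with 0 ≤ a, b ≤ q − 1 such that the monomial x^a y^b is (Φ, q−r)*-good, i.e., such that for every α, β, γ ∈ F_q the remainder of X^a·(αX²+βX+γ)^b upon division by X^q − X has degree less than q − r. -/

import Mathlib

open Polynomial in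
lemma aux_monic (F : Type*) [Field F] (q : ℕ) (hq : 2 ≤ q) :
    (X ^ q - X : F[X]).Monic ∧ (X ^ q - X : F[X]).degree = (q : WithBot ℕ) := by
  have h1 : (X : F[X]).degree < (q : WithBot ℕ) := by
    rw [degree_X]; exact_mod_cast hq
  have hm : (X ^ q - X : F[X]).Monic := monic_X_pow_sub h1
  refine ⟨hm, ?_⟩
  rw [degree_eq_natDegree hm.ne_zero, FiniteField.X_pow_card_sub_X_natDegree_eq F (by omega)]

open Polynomial in
lemma aux_scale (F : Type*) [Field F] [Fintype F] (q : ℕ) (hq : Fintype.card F = q) (hq2 : 2 ≤ q)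
    (p : F[X]) (s : F) (n : ℕ) :
    ((p.comp (C s * X)) %ₘ (X ^ q - X)).coeff n = (p %ₘ (X ^ q - X)).coeff n * s ^ n := by
  obtain ⟨hm, hd⟩ := aux_monic F q hq2
  have hs : s ^ q = s := by rw [← hq]; exact FiniteField.pow_card s
  have h := div_modByMonic_unique (f := p.comp (C s * X)) (C s * (p /ₘ (X ^ q - X)).comp (C s * X))
    ((p %ₘ (X ^ q - X)).comp (C s * X)) hm ⟨by
      conv_rhs => rw [← modByMonic_add_div p (X ^ q - X)]
      simp only [add_comp, mul_comp, sub_comp, pow_comp, X_comp, mul_pow, ← C_pow, hs]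
      ring, by
      rw [hd, degree_lt_iff_coeff_zero]
      intro m hmm
      have h2 := degree_modByMonic_lt p hm
      rw [hd, degree_lt_iff_coeff_zero] at h2
      rw [comp_C_mul_X_coeff, h2 m hmm, zero_mul]⟩
  rw [h.2, comp_C_mul_X_coeff]

open Polynomial in
lemma aux_uni (F : Type*) [Field F] [Fintype F] (q : ℕ) (hq : Fintype.card F = q) (hq2 : 2 ≤ q)
    (d : ℕ → F) (h : ∀ s : F, s ≠ 0 → ∑ a ∈ Finset.range q, d a * s ^ a = 0) :
    (∀ a, 0 < a → a < q - 1 → d a = 0) ∧ d 0 + d (q - 1) = 0 := by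
  classical
  have hp : ∀ a < q - 1, (if a = 0 then d 0 + d (q - 1) else d a) = 0 := by
    set P : F[X] := ∑ a ∈ Finset.range (q - 1),
      C (if a = 0 then d 0 + d (q - 1) else d a) * X ^ a with hP
    have hc : ∀ a < q - 1, P.coeff a = (if a = 0 then d 0 + d (q - 1) else d a) := by
      intro a ha
      rw [hP, finsetSum_coeff]
      simp only [coeff_C_mul_X_pow]
      simp [Finset.sum_ite_eq, ha]
    have hdeg : P.degree < ((q - 1 : ℕ) : WithBot ℕ) := by
      rw [degree_lt_iff_coeff_zero]
      intro m hm
      rw [hP, finsetSum_coeff]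
      apply Finset.sum_eq_zero
      intro a ha
      rw [coeff_C_mul_X_pow, if_neg]
      have := Finset.mem_range.1 ha
      omega
    have h0 : P = 0 := by
      apply eq_of_degree_sub_lt_of_eval_finset_eq (Finset.univ.erase (0 : F))
      · rw [Finset.card_erase_of_mem (Finset.mem_univ _), Finset.card_univ, hq, sub_zero]
        exact hdeg
      · intro s hs
        have hs0 : s ≠ 0 := Finset.ne_of_mem_erase hs
        have h1 := h s hs0
        have h2 : s ^ (q - 1) = 1 := by
          rw [← hq]; exact FiniteField.pow_card_sub_one_eq_one s hs0
        obtain ⟨k, rfl⟩ : ∃ k, q = k + 2 := ⟨q - 2, by omega⟩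
        have e : k + 2 - 1 = k + 1 := rfl
        rw [e] at h2
        rw [eval_zero, hP, eval_finsetSum]
        simp only [e, eval_mul, eval_C, eval_pow, eval_X]
        rw [Finset.sum_range_succ, h2, Finset.sum_range_succ'] at h1
        rw [Finset.sum_range_succ']
        simp only [Nat.add_eq_zero_iff, one_ne_zero, and_false, if_false, if_true, pow_zero] at h1 ⊢
        rw [← h1]; ring
    intro a ha
    rw [← hc a ha, h0, coeff_zero]
  constructor
  · intro a h1 h2
    simpa [h1.ne'] using hp a h2
  · simpa using hp 0 (by omega)

open Polynomial in
lemma aux_core (F : Type*) [Field F] [Fintype F] (q : ℕ) (hq : Fintype.card F = q) (hq2 : 2 ≤ q)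
    (r : ℕ) (hr1 : 1 ≤ r) (hr2 : r ≤ q - 1) (c : ℕ → ℕ → F)
    (h : ∀ α β γ : F, ∀ n, q - r ≤ n → ∑ a ∈ Finset.range q, ∑ b ∈ Finset.range q,
      c a b * ((X ^ a * (C α * X ^ 2 + C β * X + C γ) ^ b) %ₘ (X ^ q - X)).coeff n = 0)
    (α β γ : F) (n : ℕ) (hn : q - r ≤ n) (a b : ℕ) (ha : a < q) (hb : b < q) :
    c a b * ((X ^ a * (C α * X ^ 2 + C β * X + C γ) ^ b) %ₘ (X ^ q - X)).coeff n = 0 := by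
  obtain ⟨hm, hd⟩ := aux_monic F q hq2
  set M : F → F → F → ℕ → ℕ → ℕ → F := fun α β γ n a b =>
    ((X ^ a * (C α * X ^ 2 + C β * X + C γ) ^ b) %ₘ (X ^ q - X)).coeff n with hM
  change ∀ α β γ : F, ∀ n, q - r ≤ n → ∑ a ∈ Finset.range q, ∑ b ∈ Finset.range q,
      c a b * M α β γ n a b = 0 at h
  change c a b * M α β γ n a b = 0
  -- scaling identity
  have hsc : ∀ α β γ s t n a b, M (t * α * s ^ 2) (t * β * s) (t * γ) n a b * s ^ a =
      t ^ b * M α β γ n a b * s ^ n := by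
    intro α β γ s t n a b
    have h1 := aux_scale F q hq hq2 (C (t ^ b) * (X ^ a * (C α * X ^ 2 + C β * X + C γ) ^ b)) s n
    have h2 : (C (t ^ b) * (X ^ a * (C α * X ^ 2 + C β * X + C γ) ^ b)).comp (C s * X) =
        (s ^ a) • (X ^ a * (C (t * α * s ^ 2) * X ^ 2 + C (t * β * s) * X + C (t * γ)) ^ b) := by
      have h3 : (C (t * α * s ^ 2) * X ^ 2 + C (t * β * s) * X + C (t * γ) : F[X]) =
          C t * (C α * (C s * X) ^ 2 + C β * (C s * X) + C γ) := by
        simp only [C_mul, C_pow]; ring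
      rw [h3, smul_eq_C_mul]
      simp only [mul_comp, add_comp, pow_comp, C_comp, X_comp, mul_pow, C_pow]
      ring
    rw [h2, ← smul_eq_C_mul (p := X ^ a * _), smul_modByMonic, smul_modByMonic, coeff_smul, coeff_smul,
      smul_eq_mul, smul_eq_mul] at h1
    rw [mul_comm]; exact h1
  have key : ∀ α β γ n, q - r ≤ n → ∀ t s : F, t ≠ 0 → s ≠ 0 →
      ∑ a ∈ Finset.range q, (∑ b ∈ Finset.range q, c a b * M α β γ n a b * t ^ b) * s ^ a = 0 := by
    intro α β γ n hn t s ht hs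
    have h1 := h (t * α * s⁻¹ ^ 2) (t * β * s⁻¹) (t * γ) n hn
    have h2 : ∀ a b, M (t * α * s⁻¹ ^ 2) (t * β * s⁻¹) (t * γ) n a b =
        t ^ b * M α β γ n a b * s ^ a * s⁻¹ ^ n := by
      intro a b
      have h3 := hsc α β γ s⁻¹ t n a b
      have h4 : s⁻¹ ^ a * s ^ a = 1 := by rw [← mul_pow, inv_mul_cancel₀ hs, one_pow]
      calc _ = M (t * α * s⁻¹ ^ 2) (t * β * s⁻¹) (t * γ) n a b * s⁻¹ ^ a * s ^ a := by
            rw [mul_assoc (M _ _ _ _ _ _), h4, mul_one]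
        _ = _ := by rw [h3]; ring
    have h5 : (∑ a ∈ Finset.range q, (∑ b ∈ Finset.range q,
        c a b * M α β γ n a b * t ^ b) * s ^ a) * s⁻¹ ^ n = 0 := by
      rw [← h1, Finset.sum_mul]
      refine Finset.sum_congr rfl fun a _ => ?_
      rw [Finset.sum_mul, Finset.sum_mul]
      refine Finset.sum_congr rfl fun b _ => ?_
      rw [h2]; ring
    exact (mul_eq_zero.1 h5).resolve_right (pow_ne_zero _ (inv_ne_zero hs))
  have k1 : ∀ α β γ n, q - r ≤ n → ∀ a, 0 < a → a < q - 1 →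
      (∀ b, 0 < b → b < q - 1 → c a b * M α β γ n a b = 0) ∧
      c a 0 * M α β γ n a 0 + c a (q - 1) * M α β γ n a (q - 1) = 0 := by
    intro α β γ n hn a h1 h2
    exact aux_uni F q hq hq2 (fun b => c a b * M α β γ n a b) fun t ht =>
      (aux_uni F q hq hq2 _ fun s hs => key α β γ n hn t s ht hs).1 a h1 h2
  have k2 : ∀ α β γ n, q - r ≤ n →
      (∀ b, 0 < b → b < q - 1 →
        c 0 b * M α β γ n 0 b + c (q - 1) b * M α β γ n (q - 1) b = 0) ∧
      (c 0 0 * M α β γ n 0 0 + c (q - 1) 0 * M α β γ n (q - 1) 0) +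
      (c 0 (q - 1) * M α β γ n 0 (q - 1) + c (q - 1) (q - 1) * M α β γ n (q - 1) (q - 1)) = 0 := by
    intro α β γ n hn
    refine aux_uni F q hq hq2
      (fun b => c 0 b * M α β γ n 0 b + c (q - 1) b * M α β γ n (q - 1) b) fun t ht => ?_
    rw [← (aux_uni F q hq hq2 _ fun s hs => key α β γ n hn t s ht hs).2, ← Finset.sum_add_distrib]
    exact Finset.sum_congr rfl fun b _ => by ring
  -- special values
  have hX : ∀ a n, a < q → ((X ^ a : F[X]) %ₘ (X ^ q - X)).coeff n = if n = a then 1 else 0 := by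
    intro a n ha
    rw [(modByMonic_eq_self_iff hm).2, coeff_X_pow]
    rw [hd, degree_X_pow]; exact_mod_cast ha
  have m0 : ∀ α β γ n a, a < q → M α β γ n a 0 = if n = a then 1 else 0 := by
    intro α β γ n a ha
    simp only [hM, pow_zero, mul_one]; exact hX a n ha
  have mz : ∀ n a b, 0 < b → M 0 0 0 n a b = 0 := by
    intro n a b hb
    simp [hM, hb.ne']
  have mo : ∀ n a b, a < q → M 0 0 1 n a b = if n = a then 1 else 0 := by
    intro n a b ha
    simp only [hM, C_0, zero_mul, zero_add, C_1, one_pow, mul_one]; exact hX a n ha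
  have hr3 : q - r ≤ q - 1 := by omega
  have hq1 : q - 1 ≠ 0 := by omega
  have hlt : q - 1 < q := by omega
  have hn0 : n ≠ 0 := by omega
  have hc1 : ∀ b, 0 < b → b < q - 1 → c (q - 1) b = 0 := by
    intro b h1 h2
    have := (k2 0 0 1 (q - 1) hr3).1 b h1 h2
    simpa [mo _ _ _ hlt, mo _ _ _ (by omega : 0 < q), hq1] using this
  have hc2 : c (q - 1) 0 = 0 := by
    have := (k2 0 0 0 (q - 1) hr3).2
    rw [mz _ 0 (q - 1) (by omega), mz _ (q - 1) (q - 1) (by omega), m0 _ _ _ _ _ hlt,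
      m0 _ _ _ _ _ (by omega : 0 < q)] at this
    simpa [hq1] using this
  have hc3 : c (q - 1) (q - 1) = 0 := by
    have := (k2 0 0 1 (q - 1) hr3).2
    rw [hc2] at this
    simpa [mo _ _ _ hlt, mo _ _ _ (by omega : 0 < q), hq1] using this
  have m00 : M α β γ n 0 0 = 0 := by rw [m0 _ _ _ _ _ (by omega), if_neg hn0]
  rcases (by omega : a = 0 ∨ (0 < a ∧ a < q - 1) ∨ a = q - 1) with rfl | ⟨a1, a2⟩ | rfl
  · rcases (by omega : b = 0 ∨ (0 < b ∧ b < q - 1) ∨ b = q - 1) with rfl | ⟨b1, b2⟩ | rfl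
    · rw [m00, mul_zero]
    · have := (k2 α β γ n hn).1 b b1 b2
      rwa [hc1 b b1 b2, zero_mul, add_zero] at this
    · have := (k2 α β γ n hn).2
      rwa [m00, hc2, hc3, mul_zero, zero_mul, zero_mul, add_zero, add_zero, zero_add] at this
  · have z0 : c a 0 * M α β γ n a 0 = 0 := by
      have := (k1 0 0 0 n hn a a1 a2).2
      rw [mz _ a (q - 1) (by omega), mul_zero, add_zero, m0 _ _ _ _ _ ha] at this
      rwa [m0 _ _ _ _ _ ha]
    rcases (by omega : b = 0 ∨ (0 < b ∧ b < q - 1) ∨ b = q - 1) with rfl | ⟨b1, b2⟩ | rfl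
    · exact z0
    · exact (k1 α β γ n hn a a1 a2).1 b b1 b2
    · have := (k1 α β γ n hn a a1 a2).2
      rwa [z0, zero_add] at this
  · rcases (by omega : b = 0 ∨ (0 < b ∧ b < q - 1) ∨ b = q - 1) with rfl | ⟨b1, b2⟩ | rfl
    · rw [hc2, zero_mul]
    · rw [hc1 b b1 b2, zero_mul]
    · rw [hc3, zero_mul]


/-- The dimension of the quadratic-lifted Reed–Solomon code `C` over
`F_q` equals the number of `(Φ, q−r)*`-good monomials `x^a y^b` with `0 ≤ a, b ≤ q−1`. -/
theorem stmt_9 (F : Type*) [Field F] [Fintype F]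
    (ℓ : ℕ) (hℓ : 1 ≤ ℓ) (hF : Fintype.card F = 2 ^ ℓ)
    (r : ℕ) (hr1 : 1 ≤ r) (hr2 : r ≤ 2 ^ ℓ - 1)
    (Cod : Submodule F (MvPolynomial (Fin 2) F))
    (hCod : ∀ f : MvPolynomial (Fin 2) F, f ∈ Cod ↔
      (MvPolynomial.degreeOf 0 f ≤ 2 ^ ℓ - 1 ∧ MvPolynomial.degreeOf 1 f ≤ 2 ^ ℓ - 1 ∧
        ∀ α β γ : F,
          ((MvPolynomial.aeval
                ![Polynomial.X,
                  Polynomial.C α * Polynomial.X ^ 2 + Polynomial.C β * Polynomial.X +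
                    Polynomial.C γ] f) %ₘ
              (Polynomial.X ^ (2 ^ ℓ) - Polynomial.X)).degree <
            ((2 ^ ℓ - r : ℕ) : WithBot ℕ))) :
    Module.finrank F Cod =
      Nat.card {p : ℕ × ℕ // p.1 ≤ 2 ^ ℓ - 1 ∧ p.2 ≤ 2 ^ ℓ - 1 ∧
        ∀ α β γ : F,
          ((Polynomial.X ^ p.1 *
                (Polynomial.C α * Polynomial.X ^ 2 + Polynomial.C β * Polynomial.X +
                  Polynomial.C γ) ^ p.2) %ₘ
              (Polynomial.X ^ (2 ^ ℓ) - Polynomial.X)).degree <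
            ((2 ^ ℓ - r : ℕ) : WithBot ℕ)} := by
  classical
  have hq2 : 2 ≤ 2 ^ ℓ := by
    calc 2 = 2 ^ 1 := rfl
      _ ≤ 2 ^ ℓ := Nat.pow_le_pow_right (by norm_num) hℓ
  generalize 2 ^ ℓ = q at *
  let G : ℕ × ℕ → Prop := fun p => p.1 ≤ q - 1 ∧ p.2 ≤ q - 1 ∧
        ∀ α β γ : F,
          ((Polynomial.X ^ p.1 *
                (Polynomial.C α * Polynomial.X ^ 2 + Polynomial.C β * Polynomial.X +
                  Polynomial.C γ) ^ p.2) %ₘ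
              (Polynomial.X ^ q - Polynomial.X)).degree <
            ((q - r : ℕ) : WithBot ℕ)
  change _ = Nat.card {p : ℕ × ℕ // G p}
  let S : Set (Fin 2 →₀ ℕ) := {m | G (m 0, m 1)}
  have hmon : ∀ (m : Fin 2 →₀ ℕ) (c : F) (φ : Polynomial F),
      MvPolynomial.aeval ![Polynomial.X, φ] (MvPolynomial.monomial m c) =
        c • (Polynomial.X ^ (m 0) * φ ^ (m 1)) := by
    intro m c φ
    rw [MvPolynomial.aeval_monomial, Finsupp.prod_fintype _ _ (by simp), Fin.prod_univ_two,
      Algebra.smul_def]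
    rfl
  have hCS : Cod = MvPolynomial.restrictSupport F S := by
    ext f
    rw [MvPolynomial.mem_restrictSupport_iff]
    constructor
    · intro hf m hm
      obtain ⟨d0, d1, hg⟩ := (hCod f).1 hf
      rw [MvPolynomial.degreeOf_le_iff] at d0 d1
      let e : ℕ × ℕ → (Fin 2 →₀ ℕ) := fun p => Finsupp.single 0 p.1 + Finsupp.single 1 p.2
      have e0 : ∀ p, e p 0 = p.1 := by intro p; simp [e]
      have e1 : ∀ p, e p 1 = p.2 := by intro p; simp [e]
      have ee : ∀ m : Fin 2 →₀ ℕ, e (m 0, m 1) = m := by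
        intro m; ext i; fin_cases i
        · exact e0 _
        · exact e1 _
      have hfs : f = ∑ p ∈ Finset.range q ×ˢ Finset.range q,
          MvPolynomial.monomial (e p) (f.coeff (e p)) := by
        conv_lhs => rw [MvPolynomial.as_sum f]
        symm
        apply Finset.sum_bij_ne_zero (fun p _ _ => e p)
        · intro p _ hp
          rw [MvPolynomial.mem_support_iff]
          intro h0; apply hp; rw [h0, MvPolynomial.monomial_zero]
        · intro p _ _ p' _ _ h
          exact Prod.ext (by rw [← e0 p, h, e0]) (by rw [← e1 p, h, e1])
        · intro m hm hm0
          refine ⟨(m 0, m 1), ?_, ?_, ee m⟩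
          · have := d0 m hm
            have := d1 m hm
            simp only [Finset.mem_product, Finset.mem_range]; omega
          · rw [ee]; exact hm0
        · intros; rfl
      have hcore := aux_core F q hF hq2 r hr1 hr2 (fun a b => f.coeff (e (a, b))) (by
        intro α β γ n hn
        have h1 := (Polynomial.degree_lt_iff_coeff_zero _ _).1 (hg α β γ) n hn
        rw [hfs, map_sum] at h1
        simp only [hmon, e0, e1] at h1
        rw [← Finset.sum_product', ← h1, ← Polynomial.modByMonicHom_apply, map_sum,
          Polynomial.finsetSum_coeff]
        refine Finset.sum_congr rfl fun p _ => ?_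
        rw [map_smul, Polynomial.coeff_smul, smul_eq_mul, Polynomial.modByMonicHom_apply])
      have hm' : m ∈ f.support := hm
      refine ⟨d0 m hm', d1 m hm', fun α β γ => ?_⟩
      rw [Polynomial.degree_lt_iff_coeff_zero]
      intro n hn
      have a0 := d0 m hm'
      have a1 := d1 m hm'
      have h2 := hcore α β γ n hn (m 0) (m 1) (by omega) (by omega)
      rw [ee] at h2
      exact (mul_eq_zero.1 h2).resolve_left (MvPolynomial.mem_support_iff.1 hm')
    · intro hf
      rw [MvPolynomial.as_sum f]
      refine Submodule.sum_mem _ fun m hm => ?_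
      obtain ⟨g0, g1, g2⟩ : G (m 0, m 1) := hf hm
      have hc := MvPolynomial.mem_support_iff.1 hm
      rw [hCod, MvPolynomial.degreeOf_monomial_eq _ _ hc, MvPolynomial.degreeOf_monomial_eq _ _ hc]
      refine ⟨g0, g1, fun α β γ => ?_⟩
      rw [hmon, Polynomial.smul_modByMonic]
      exact (Polynomial.degree_smul_le _ _).trans_lt (g2 α β γ)
  rw [hCS, Module.finrank_eq_nat_card_basis (MvPolynomial.basisRestrictSupport F S)]
  refine Nat.card_congr ⟨fun m => ⟨(m.1 0, m.1 1), m.2⟩,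
    fun p => ⟨Finsupp.single 0 p.1.1 + Finsupp.single 1 p.1.2, ?_⟩, ?_, ?_⟩
  · have := p.2
    simpa [S] using this
  · rintro ⟨m, hm⟩
    apply Subtype.ext
    ext i
    fin_cases i <;> simp
  · rintro ⟨⟨a, b⟩, hp⟩
    simp
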